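/- Suppose the augmentation is a (σ,δ)-augmentation, the encoder f is L-Lipschitz with ‖f(x)‖ = r for all x, and ε>0. If for every pair (ℓ,k) with ℓ ≠ k one has μ_ℓᵀμ_k < r²·(1 − ρ_max(σ,δ,ε) − √(2ρ_max(σ,δ,ε)) − Δ_μ/2), where ρ_max(σ,δ,ε) = 2(1−σ) + R_ε/min_{ℓ∈[K]} p_ℓ + σ(Lδ/r + 2ε/r) and Δ_μ = 1 − min_{k∈[K]} ‖μ_k‖²/r², then the nearest-neighbor classifier G_f satisfies Err(G_f) ≤ (1−σ) + R_ε. -/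

import Mathlib

open MeasureTheory

noncomputable section

/-- The augmented distance `d_A(x₁,x₂) = min_{x₁'∈A(x₁), x₂'∈A(x₂)} ‖x₁'−x₂'‖`. -/
def augDist {N : ℕ} (A : EuclideanSpace ℝ (Fin N) → Set (EuclideanSpace ℝ (Fin N)))
    (x₁ x₂ : EuclideanSpace ℝ (Fin N)) : ℝ :=
  sInf {r : ℝ | ∃ y₁ ∈ A x₁, ∃ y₂ ∈ A x₂, r = ‖y₁ - y₂‖}

/-- The set `S_ε` of points all of whose augmented views have `ε`-close embeddings. -/
def goodSet {N d : ℕ} (A : EuclideanSpace ℝ (Fin N) → Set (EuclideanSpace ℝ (Fin N)))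
    (f : EuclideanSpace ℝ (Fin N) → EuclideanSpace ℝ (Fin d)) (ε : ℝ) :
    Set (EuclideanSpace ℝ (Fin N)) :=
  {x | ∀ y₁ ∈ A x, ∀ y₂ ∈ A x, ‖f y₁ - f y₂‖ ≤ ε}

/-- `(σ,δ)`-augmentation: each class `C k` has a measurable main part `C₀ k ⊆ C k`
with `P[C₀ k] ≥ σ·P[C k]` and augmented diameter at most `δ`. -/
def IsSigmaDeltaAug {N K : ℕ} (P : Measure (EuclideanSpace ℝ (Fin N)))
    (A : EuclideanSpace ℝ (Fin N) → Set (EuclideanSpace ℝ (Fin N)))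
    (C C₀ : Fin K → Set (EuclideanSpace ℝ (Fin N))) (σ δ : ℝ) : Prop :=
  ∀ k, MeasurableSet (C₀ k) ∧ C₀ k ⊆ C k ∧
    σ * (P (C k)).toReal ≤ (P (C₀ k)).toReal ∧
    ∀ x₁ ∈ C₀ k, ∀ x₂ ∈ C₀ k, augDist A x₁ x₂ ≤ δ


/-- The class center `μ = E_{x∈C} E_{x'∈A(x)}[f(x')]`, where the inner expectation
is over the view distribution `ν x` and the outer one is `P` conditioned on `C`. -/
def center {N d : ℕ} (P : Measure (EuclideanSpace ℝ (Fin N)))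
    (ν : EuclideanSpace ℝ (Fin N) → Measure (EuclideanSpace ℝ (Fin N)))
    (C : Set (EuclideanSpace ℝ (Fin N)))
    (f : EuclideanSpace ℝ (Fin N) → EuclideanSpace ℝ (Fin d)) :
    EuclideanSpace ℝ (Fin d) :=
  ⨍ x in C, (∫ y, f y ∂(ν x)) ∂P

theorem numeric_final (u v s : ℝ) (hu1 : u ≤ 1) (hu0 : 0 ≤ u) (hv : 1 < v) (hs : 0 ≤ s)
    (hsv : s ≤ v ^ 2 - v) (huv : v ^ 2 + 2 * v - 1 < u ^ 2 + 2 * u)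
    (h : (1 - v ^ 2 / 2 + s) * (v - s) ^ 2 ≤ 1 - u ^ 2) : False := by
  have hv2 : v < 1.24 := by nlinarith
  have hbr : 0 ≤ v ^ 2 - 2 * v + v ^ 3 + s * (1 - v ^ 2 / 2 - 2 * v) + s ^ 2 := by
    have h1 : 0 ≤ (v ^ 2 - v - s) * (v ^ 2 / 2 + 2 * v - 1) := by
      apply mul_nonneg <;> nlinarith
    have h2 : 0 ≤ v * (v - 1) * (v + 2 - (v ^ 2 / 2 + 2 * v - 1)) := by
      apply mul_nonneg <;> nlinarith
    nlinarith [sq_nonneg s]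
  have h3 : v ^ 2 * (1 - v ^ 2 / 2) ≤ (1 - v ^ 2 / 2 + s) * (v - s) ^ 2 := by
    nlinarith [mul_nonneg hs hbr]
  have h4 : u ^ 2 ≤ 1 / 2 + (v ^ 2 - 1) ^ 2 / 2 := by nlinarith
  rcases le_total v 1.12 with h5 | h5
  · have h6 : v ^ 2 - 1 ≤ 0.2544 := by nlinarith
    have h7 : (v ^ 2 - 1) ^ 2 ≤ 0.2544 ^ 2 := by
      apply pow_le_pow_left₀ _ h6; nlinarith
    have h8 : u ≤ 0.73 := by
      by_contra hc
      push Not at hc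
      nlinarith
    nlinarith
  · have h6 : v ^ 2 - 1 ≤ 0.5376 := by nlinarith
    have h7 : (v ^ 2 - 1) ^ 2 ≤ 0.5376 ^ 2 := by
      apply pow_le_pow_left₀ _ h6; nlinarith
    have h8 : u ≤ 0.81 := by
      by_contra hc
      push Not at hc
      nlinarith
    nlinarith

theorem numeric_core (I ρ v m τ h s u w D q : ℝ)
    (hdiv : I < 1 - ρ - v - (1 - m) / 2) (hv : 0 ≤ v) (hvρ : v ^ 2 = 2 * ρ)
    (hρ : ρ = 2 * τ + h + (1 - τ) * s) (hτ : 0 ≤ τ) (hτ1 : τ ≤ 1) (hh : 0 ≤ h) (hs : 0 ≤ s)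
    (hI : -(u * w) ≤ I) (hmu : m ≤ u ^ 2) (hmw : m ≤ w ^ 2)
    (hu : 0 ≤ u) (hu1 : u ≤ 1) (hw1 : w ≤ 1)
    (hq : 1 - τ - h ≤ q)
    (hD0 : 0 ≤ D) (hD : D ≤ 2 - q * (2 - s))
    (hvar : s ≤ D → q * (D - s) ^ 2 ≤ 1 - u ^ 2)
    (hmis : 1 / 2 + w ^ 2 / 2 - D ^ 2 / 2 - D * w ≤ I) : False := by
  have huw : u * w ≤ u := mul_le_of_le_one_right hu hw1
  have hm1 : m ≤ 1 := by nlinarith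
  have hρ1 : ρ < 1 := by
    by_contra hc
    push Not at hc
    have : 1 ≤ v := by nlinarith
    nlinarith
  have hs1 : s < 1 := by
    by_contra hc
    push Not at hc
    have := mul_nonneg (sub_nonneg.2 hτ1) (sub_nonneg.2 hc)
    nlinarith
  have hρ2 : τ + h + s ≤ ρ := by
    have := mul_nonneg hτ (sub_nonneg.2 hs1.le)
    nlinarith
  obtain ⟨t, ht⟩ : ∃ t, t = τ + h := ⟨_, rfl⟩
  have ht0 : 0 ≤ t := by linarith
  have htq : 1 - t ≤ q := by linarith
  have htρ : t + s ≤ ρ := by linarith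
  have hD2 : D ≤ 2 * t + s * (1 - t) := by
    have := mul_nonneg (sub_nonneg.2 htq) (by linarith : 0 ≤ 2 - s)
    nlinarith
  have hst : 0 ≤ s * t := mul_nonneg hs ht0
  have hDv : v < D := by
    by_contra hc
    push Not at hc
    have h1 : D * w ≤ D := mul_le_of_le_one_right hD0 hw1
    have h2 : D ^ 2 ≤ v ^ 2 := pow_le_pow_left₀ hD0 hc 2
    nlinarith
  have hDs : D ≤ v ^ 2 - s := by nlinarith
  have hv1 : 1 < v := by
    by_contra hc
    push Not at hc
    nlinarith
  have hsv : s ≤ v ^ 2 - v := by linarith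
  have huv : v ^ 2 + 2 * v - 1 < u ^ 2 + 2 * u := by nlinarith
  have hvs : s ≤ v := by linarith
  refine numeric_final u v s hu1 hu hv1 hs hsv huv (le_trans ?_ (hvar (by linarith)))
  have h1 : (v - s) ^ 2 ≤ (D - s) ^ 2 := pow_le_pow_left₀ (by linarith) (by linarith) 2
  have h2 : 1 - v ^ 2 / 2 + s ≤ q := by linarith
  have h3 : 0 ≤ q := by linarith
  exact (mul_le_mul_of_nonneg_right h2 (sq_nonneg _)).trans (mul_le_mul_of_nonneg_left h1 h3)

/-- The two facts on the centre: distance bound and variance bound. -/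
theorem center_bounds {Ω E : Type*} [MeasurableSpace Ω] [NormedAddCommGroup E]
    [InnerProductSpace ℝ E] [CompleteSpace E]
    (Q : Measure Ω) [IsProbabilityMeasure Q] (Y : Ω → E) (hY : Integrable Y Q)
    (r : ℝ) (hr : ∀ z, ‖Y z‖ ≤ r) (a : E) (ha : ‖a‖ ≤ r) (M : Set Ω) (hM : MeasurableSet M)
    (e : ℝ) (hMe : ∀ z ∈ M, ‖a - Y z‖ ≤ e) :
    ‖∫ z, Y z ∂Q‖ ≤ r ∧
    ‖a - ∫ z, Y z ∂Q‖ ≤ 2 * r - Q.real M * (2 * r - e) ∧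
    (e ≤ ‖a - ∫ z, Y z ∂Q‖ →
      Q.real M * (‖a - ∫ z, Y z ∂Q‖ - e) ^ 2 ≤ r ^ 2 - ‖∫ z, Y z ∂Q‖ ^ 2) := by
  have hr0 : 0 ≤ r := (norm_nonneg a).trans ha
  have hind : ∀ c : ℝ, Integrable (M.indicator fun _ => c) Q :=
    fun c => (integrable_const c).indicator hM
  have hindi : ∀ c : ℝ, ∫ z, M.indicator (fun _ => c) z ∂Q = Q.real M * c := by
    intro c
    rw [integral_indicator_const _ hM, smul_eq_mul]
  refine ⟨?_, ?_, ?_⟩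
  · have := norm_integral_le_of_norm_le_const (μ := Q) (Filter.Eventually.of_forall hr)
    simpa using this
  · have h1 : a - ∫ z, Y z ∂Q = ∫ z, (a - Y z) ∂Q := by
      rw [integral_sub (integrable_const a) hY]; simp
    rw [h1]
    have h2 : ∫ z, (2 * r - M.indicator (fun _ => 2 * r - e) z) ∂Q
        = 2 * r - Q.real M * (2 * r - e) := by
      rw [integral_sub (integrable_const _) (hind _), hindi]; simp
    rw [← h2]
    have hi : Integrable (fun z => 2 * r - M.indicator (fun _ => 2 * r - e) z) Q :=
      (integrable_const _).sub (hind _)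
    refine norm_integral_le_of_norm_le hi (Filter.Eventually.of_forall fun z => ?_)
    by_cases hz : z ∈ M
    · simp only [Set.indicator_of_mem hz]; linarith [hMe z hz]
    · simp only [Set.indicator_of_notMem hz]
      linarith [norm_sub_le a (Y z), hr z]
  · intro he
    set c := ∫ z, Y z ∂Q with hc
    rw [← hindi]
    have hin : Integrable (fun z => inner ℝ c (Y z)) Q := hY.const_inner c
    have hi : Integrable (fun z => r ^ 2 - 2 * inner ℝ c (Y z)) Q :=
      (integrable_const _).sub (hin.const_mul 2)
    have h2 : ∫ z, (r ^ 2 - 2 * inner ℝ c (Y z) + ‖c‖ ^ 2) ∂Q = r ^ 2 - ‖c‖ ^ 2 := by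
      rw [integral_add hi (integrable_const _),
        integral_sub (integrable_const _) (hin.const_mul 2), integral_const_mul,
        integral_inner hY c, ← hc, real_inner_self_eq_norm_sq]
      simp
      ring
    rw [← h2]
    apply integral_mono (hind _)
      (hi.add (integrable_const _))
    intro z
    have h3 : ‖c - Y z‖ ^ 2 ≤ r ^ 2 - 2 * inner ℝ c (Y z) + ‖c‖ ^ 2 := by
      rw [norm_sub_sq_real]
      nlinarith [pow_le_pow_left₀ (norm_nonneg _) (hr z) 2]
    by_cases hz : z ∈ M
    · simp only [Set.indicator_of_mem hz]
      refine le_trans (pow_le_pow_left₀ (by linarith) ?_ 2) h3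
      have : ‖a - c‖ ≤ ‖a - Y z‖ + ‖Y z - c‖ := norm_sub_le_norm_sub_add_norm_sub _ _ _
      rw [norm_sub_rev (Y z)] at this
      linarith [hMe z hz]
    · simp only [Set.indicator_of_notMem hz]
      exact (sq_nonneg _).trans h3

theorem close_main {N d : ℕ} (A : EuclideanSpace ℝ (Fin N) → Set (EuclideanSpace ℝ (Fin N)))
    (hA : ∀ x, x ∈ A x)
    (f : EuclideanSpace ℝ (Fin N) → EuclideanSpace ℝ (Fin d)) (L δ ε : ℝ) (hL : 0 ≤ L)
    (hLip : ∀ x₁ x₂, ‖f x₁ - f x₂‖ ≤ L * ‖x₁ - x₂‖)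
    (x z : EuclideanSpace ℝ (Fin N)) (hx : x ∈ goodSet A f ε) (hz : z ∈ goodSet A f ε)
    (hxz : augDist A x z ≤ δ) (y : EuclideanSpace ℝ (Fin N)) (hy : y ∈ A z) :
    ‖f x - f y‖ ≤ L * δ + 2 * ε := by
  have key : ∀ η > 0, ‖f x - f y‖ ≤ L * (δ + η) + 2 * ε := by
    intro η hη
    obtain ⟨_, ⟨y₁, h1, y₂, h2, rfl⟩, h3⟩ := exists_lt_of_csInf_lt
      (s := {r : ℝ | ∃ y₁ ∈ A x, ∃ y₂ ∈ A z, r = ‖y₁ - y₂‖})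
      ⟨_, x, hA x, z, hA z, rfl⟩ (lt_of_le_of_lt hxz (lt_add_of_pos_right δ hη))
    have e1 := hx x (hA x) y₁ h1
    have e2 := hz y₂ h2 y hy
    have e3 := (hLip y₁ y₂).trans (mul_le_mul_of_nonneg_left h3.le hL)
    have e4 : ‖f x - f y‖ ≤ ‖f x - f y₁‖ + ‖f y₁ - f y‖ :=
      norm_sub_le_norm_sub_add_norm_sub _ _ _
    have e5 : ‖f y₁ - f y‖ ≤ ‖f y₁ - f y₂‖ + ‖f y₂ - f y‖ :=
      norm_sub_le_norm_sub_add_norm_sub _ _ _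
    linarith
  refine le_of_forall_pos_le_add fun η hη => ?_
  have hL1 : 0 < L + 1 := by linarith
  have := key (η / (L + 1)) (by positivity)
  have h2 : L * (η / (L + 1)) ≤ η := by
    rw [mul_div_assoc', div_le_iff₀ hL1]; nlinarith
  linarith

/-- Theorem 3.3: under the divergence condition with
`ρ_max(σ,δ,ε)`, the NN classifier `G_f` satisfies `Err(G_f) ≤ (1−σ) + R_ε`. -/
theorem stmt_4 {N d K : ℕ} (hK : 0 < K)
    (P : Measure (EuclideanSpace ℝ (Fin N))) [IsProbabilityMeasure P]
    (A : EuclideanSpace ℝ (Fin N) → Set (EuclideanSpace ℝ (Fin N)))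
    (hA : ∀ x, x ∈ A x)
    (ν : EuclideanSpace ℝ (Fin N) → Measure (EuclideanSpace ℝ (Fin N)))
    (hν : ∀ x, IsProbabilityMeasure (ν x))
    (hνsupp : ∀ x, (ν x) ((A x)ᶜ) = 0)
    (C C₀ : Fin K → Set (EuclideanSpace ℝ (Fin N)))
    (hCmeas : ∀ k, MeasurableSet (C k))
    (hCdisj : ∀ k l, k ≠ l → Disjoint (C k) (C l))
    (hCtot : ∑ k, (P (C k)).toReal = 1)
    (hp : ∀ k, 0 < (P (C k)).toReal)
    (f : EuclideanSpace ℝ (Fin N) → EuclideanSpace ℝ (Fin d))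
    (hfm : Measurable f)
    (hgint : Integrable (fun x => ∫ y, f y ∂(ν x)) P)
    (r L : ℝ) (hr : 0 < r) (hL : 0 ≤ L)
    (hnorm : ∀ x, ‖f x‖ = r)
    (hLip : ∀ x₁ x₂, ‖f x₁ - f x₂‖ ≤ L * ‖x₁ - x₂‖)
    (σ δ ε : ℝ) (hσ : 0 < σ) (hσ1 : σ ≤ 1) (hδ : 0 ≤ δ) (hε : 0 < ε)
    (haug : IsSigmaDeltaAug P A C C₀ σ δ)
    (hdiv : ∀ ℓ k : Fin K, ℓ ≠ k →
      (inner ℝ (center P ν (C ℓ) f) (center P ν (C k) f) : ℝ)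
        < r ^ 2 * (1
            - (2 * (1 - σ) + (P ((goodSet A f ε)ᶜ)).toReal / (⨅ ℓ' : Fin K, (P (C ℓ')).toReal)
                + σ * (L * δ / r + 2 * ε / r))
            - Real.sqrt (2 * (2 * (1 - σ)
                + (P ((goodSet A f ε)ᶜ)).toReal / (⨅ ℓ' : Fin K, (P (C ℓ')).toReal)
                + σ * (L * δ / r + 2 * ε / r)))
            - (1 - (⨅ k' : Fin K, ‖center P ν (C k') f‖ ^ 2) / r ^ 2) / 2))
    (G : EuclideanSpace ℝ (Fin N) → Fin K)
    (hGnn : ∀ x, ∀ k : Fin K,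
      ‖f x - center P ν (C (G x)) f‖ ≤ ‖f x - center P ν (C k) f‖) :
    ∑ k, (P (C k ∩ {x | G x ≠ k})).toReal
      ≤ (1 - σ) + (P ((goodSet A f ε)ᶜ)).toReal := by
  have hne : Nonempty (Fin K) := ⟨⟨0, hK⟩⟩
  set S := goodSet A f ε with hS
  set T := toMeasurable P Sᶜ with hT
  have hTm : MeasurableSet T := measurableSet_toMeasurable _ _
  have hTP : P T = P Sᶜ := measure_toMeasurable _
  have hTS : ∀ z, z ∉ T → z ∈ S := fun z hz => by
    by_contra hc
    exact hz (subset_toMeasurable P Sᶜ hc)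
  set c : Fin K → EuclideanSpace ℝ (Fin d) := fun k => center P ν (C k) f with hcdef
  -- the inner averages
  have hfint : ∀ z, Integrable f (ν z) := fun z => by
    have := hν z
    exact Integrable.of_bound hfm.aestronglyMeasurable r
      (Filter.Eventually.of_forall fun y => (hnorm y).le)
  have hYr : ∀ z, ‖∫ y, f y ∂(ν z)‖ ≤ r := fun z => by
    have := hν z
    have h := norm_integral_le_of_norm_le_const (μ := ν z) (f := f) (C := r)
      (Filter.Eventually.of_forall fun y => (hnorm y).le)
    simpa using h
  have hclose : ∀ k, ∀ x ∈ C₀ k, x ∈ S → ∀ z ∈ C₀ k \ T,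
      ‖f x - ∫ y, f y ∂(ν z)‖ ≤ L * δ + 2 * ε := by
    intro k x hx hxS z hz
    have := hν z
    have h1 : f x - ∫ y, f y ∂(ν z) = ∫ y, (f x - f y) ∂(ν z) := by
      rw [integral_sub (integrable_const _) (hfint z)]; simp
    rw [h1]
    have h := norm_integral_le_of_norm_le_const (μ := ν z) (f := fun y => f x - f y)
      (C := L * δ + 2 * ε) (by
        have hae : ∀ᵐ y ∂(ν z), y ∈ A z := by
          rw [ae_iff]; exact hνsupp z
        filter_upwards [hae] with y hy
        exact close_main A hA f L δ ε hL hLip x z hxS (hTS z hz.2)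
          ((haug k).2.2.2 x hx z hz.1) y hy)
    simpa using h
  have hbd : ∀ k, ∀ x, ∀ M, MeasurableSet M → ∀ e, M ⊆ C k →
      (∀ z ∈ M, ‖f x - ∫ y, f y ∂(ν z)‖ ≤ e) →
      ‖c k‖ ≤ r ∧ ‖f x - c k‖ ≤ 2 * r - (P.real M / P.real (C k)) * (2 * r - e) ∧
      (e ≤ ‖f x - c k‖ →
        (P.real M / P.real (C k)) * (‖f x - c k‖ - e) ^ 2 ≤ r ^ 2 - ‖c k‖ ^ 2) := by
    intro k x M hM e hMC hMe
    have hpk : P (C k) ≠ 0 := fun h0 => by have := hp k; simp [h0] at this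
    have hpt : P (C k) ≠ ⊤ := measure_ne_top _ _
    have hQ : IsProbabilityMeasure ((P.restrict (C k) Set.univ)⁻¹ • P.restrict (C k)) := by
      constructor
      simp [ENNReal.inv_mul_cancel hpk hpt]
    have hQM : ((P.restrict (C k) Set.univ)⁻¹ • P.restrict (C k)).real M
        = P.real M / P.real (C k) := by
      simp only [Measure.real, Measure.smul_apply, Measure.restrict_apply hM,
        Set.inter_eq_left.2 hMC, smul_eq_mul, ENNReal.toReal_mul, ENNReal.toReal_inv,
        Measure.restrict_apply MeasurableSet.univ, Set.univ_inter]
      ring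
    have := center_bounds ((P.restrict (C k) Set.univ)⁻¹ • P.restrict (C k))
      (fun z => ∫ y, f y ∂(ν z))
      ((hgint.mono_measure Measure.restrict_le_self).smul_measure (by simp [hpk]))
      r hYr (f x) (hnorm x).le M hM e hMe
    rw [hQM] at this
    exact this
  have hcr : ∀ k, ‖c k‖ ≤ r := fun k =>
    (hbd k 0 ∅ MeasurableSet.empty 0 (Set.empty_subset _) (by simp)).1
  set R := (P Sᶜ).toReal with hR
  have hR0 : 0 ≤ R := ENNReal.toReal_nonneg
  set pm := ⨅ ℓ' : Fin K, (P (C ℓ')).toReal with hpm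
  have hpm_le : ∀ k, pm ≤ (P (C k)).toReal := fun k => ciInf_le (Set.finite_range _).bddBelow k
  have hpm0 : 0 < pm := by
    obtain ⟨i, hi⟩ := exists_eq_ciInf_of_finite (f := fun ℓ' : Fin K => (P (C ℓ')).toReal)
    rw [hpm, ← hi]; exact hp i
  -- correctness on the main parts
  have hcorrect : ∀ k, ∀ x ∈ C₀ k, x ∈ S → G x = k := by
    intro ℓ x hx hxS
    by_contra hG
    have hnn := hGnn x ℓ
    have hd := hdiv ℓ (G x) (Ne.symm hG)
    generalize G x = k at hnn hd
    change ‖f x - c k‖ ≤ ‖f x - c ℓ‖ at hnn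
    change inner ℝ (c ℓ) (c k) < _ at hd
    obtain ⟨hC0m, hC0C, hC0P, -⟩ := haug ℓ
    obtain ⟨-, hD, hV⟩ := hbd ℓ x (C₀ ℓ \ T) (hC0m.diff hTm) (L * δ + 2 * ε)
      (Set.sdiff_subset.trans hC0C) (hclose ℓ x hx hxS)
    set q := P.real (C₀ ℓ \ T) / P.real (C ℓ) with hqdef
    have hq : 1 - (1 - σ) - R / pm ≤ q := by
      have hpl := hp ℓ
      have h1 : P.real (C₀ ℓ) - R ≤ P.real (C₀ ℓ \ T) := by
        have h2 : P.real T = R := by rw [Measure.real, hTP]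
        rw [← h2]
        have := le_measureReal_sdiff (μ := P) (s₁ := C₀ ℓ) (s₂ := T)
        linarith
      have h3 : R / (P (C ℓ)).toReal ≤ R / pm :=
        div_le_div_of_nonneg_left hR0 hpm0 (hpm_le ℓ)
      have h4 : σ - R / (P (C ℓ)).toReal ≤ q := by
        rw [hqdef, Measure.real, Measure.real, le_div_iff₀ hpl, sub_mul, div_mul_cancel₀ _ hpl.ne']
        simp only [Measure.real] at h1 ⊢
        linarith
      linarith
    set m := ⨅ k' : Fin K, ‖center P ν (C k') f‖ ^ 2 with hm
    have hm_le : ∀ k, m ≤ ‖c k‖ ^ 2 := fun k => ciInf_le (Set.finite_range _).bddBelow k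
    have hr2 : 0 < r ^ 2 := by positivity
    set s := L * δ / r + 2 * ε / r with hs
    have hsr : L * δ + 2 * ε = r * s := by rw [hs]; field_simp
    have hs0 : 0 ≤ s := by positivity
    set ρ := 2 * (1 - σ) + R / pm + σ * s with hρ
    have hρ0 : 0 ≤ ρ := by
      have : 0 ≤ R / pm := by positivity
      have : 0 ≤ σ * s := by positivity
      linarith
    have hfx := hnorm x
    rw [hsr] at hD hV
    refine numeric_core (inner ℝ (c ℓ) (c k) / r ^ 2) ρ (Real.sqrt (2 * ρ)) (m / r ^ 2) (1 - σ)
      (R / pm) s (‖c ℓ‖ / r) (‖c k‖ / r) (‖f x - c ℓ‖ / r) q ?_ (Real.sqrt_nonneg _)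
      (Real.sq_sqrt (by positivity)) (by rw [hρ]; ring) (by linarith) (by linarith)
      (by positivity) hs0 ?_ ?_ ?_ (by positivity) ?_ ?_ hq (by positivity)
      ?_ ?_ ?_
    · rw [div_lt_iff₀ hr2]; linarith
    · rw [← mul_div_mul_comm, ← neg_div, ← sq]
      gcongr
      exact neg_le_of_abs_le (abs_real_inner_le_norm _ _)
    · rw [div_pow]; gcongr; exact hm_le ℓ
    · rw [div_pow]; gcongr; exact hm_le k
    · rw [div_le_one hr]; exact hcr ℓ
    · rw [div_le_one hr]; exact hcr k
    · rw [div_le_iff₀ hr]; linarith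
    · intro h
      rw [le_div_iff₀ hr] at h
      have h1 := hV (by linarith)
      have e1 : q * (‖f x - c ℓ‖ / r - s) ^ 2 = q * (‖f x - c ℓ‖ - r * s) ^ 2 / r ^ 2 := by
        field_simp
      have e2 : 1 - (‖c ℓ‖ / r) ^ 2 = (r ^ 2 - ‖c ℓ‖ ^ 2) / r ^ 2 := by
        field_simp
      rw [e1, e2]
      gcongr
    · rw [le_div_iff₀ hr2]
      have e1 : (1 / 2 + (‖c k‖ / r) ^ 2 / 2 - (‖f x - c ℓ‖ / r) ^ 2 / 2
          - ‖f x - c ℓ‖ / r * (‖c k‖ / r)) * r ^ 2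
          = r ^ 2 / 2 + ‖c k‖ ^ 2 / 2 - ‖f x - c ℓ‖ ^ 2 / 2 - ‖f x - c ℓ‖ * ‖c k‖ := by
        field_simp
      rw [e1]
      have h1 := pow_le_pow_left₀ (norm_nonneg _) hnn 2
      rw [norm_sub_sq_real (f x) (c k), hfx] at h1
      have h2 := real_inner_le_norm (f x - c ℓ) (c k)
      rw [inner_sub_left] at h2
      linarith
  -- the error bound
  have hk : ∀ k, (P (C k ∩ {x | G x ≠ k})).toReal
      ≤ (1 - σ) * (P (C k)).toReal + P.real (C k ∩ T) := by
    intro k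
    obtain ⟨hC0m, hC0C, hC0P, -⟩ := haug k
    have h1 : C k ∩ {x | G x ≠ k} ⊆ (C k \ C₀ k) ∪ (C k ∩ T) := by
      rintro x ⟨hx, hG⟩
      by_cases h0 : x ∈ C₀ k
      · right
        refine ⟨hx, ?_⟩
        by_contra hxT
        exact hG (hcorrect k x h0 (hTS x hxT))
      · left; exact ⟨hx, h0⟩
    have h2 : P.real (C k ∩ {x | G x ≠ k}) ≤ P.real (C k \ C₀ k) + P.real (C k ∩ T) :=
      (measureReal_mono h1).trans (measureReal_union_le _ _)
    have h3 : P.real (C k \ C₀ k) = P.real (C k) - P.real (C₀ k) :=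
      measureReal_sdiff hC0C hC0m
    simp only [Measure.real] at h2 h3 ⊢
    linarith
  have hsum : ∑ k, P.real (C k ∩ T) ≤ R := by
    have h1 : ∑ k, P.real (C k ∩ T) = P.real (⋃ k, C k ∩ T) := by
      rw [measureReal_iUnion_fintype]
      · intro i j hij
        exact (hCdisj i j hij).mono Set.inter_subset_left Set.inter_subset_left
      · exact fun k => (hCmeas k).inter hTm
    rw [h1]
    have h2 : P.real T = R := by rw [Measure.real, hTP]
    rw [← h2]
    exact measureReal_mono (Set.iUnion_subset fun k => Set.inter_subset_right)
  calc ∑ k, (P (C k ∩ {x | G x ≠ k})).toReal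
      ≤ ∑ k, ((1 - σ) * (P (C k)).toReal + P.real (C k ∩ T)) :=
        Finset.sum_le_sum fun k _ => hk k
    _ = (1 - σ) + ∑ k, P.real (C k ∩ T) := by
        rw [Finset.sum_add_distrib, ← Finset.mul_sum, hCtot, mul_one]
    _ ≤ (1 - σ) + R := by linarith
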